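/- Let X be a compact metric space, F a nonempty set of bounded continuous real-valued functions on X×X, and τ the adversarial divergence over X determined by F. Suppose τ is a strict adversarial divergence, i.e., for every Borel probability measure μ* on X, OPT_{τ,μ*} = {μ*}. Then for every μ* ∈ P(X) and every sequence (μₙ) in P(X), if τ(μ*||μₙ) → inf_{μ'∈P(X)} τ(μ*||μ'), then μₙ converges weakly to μ*, i.e., E_{μₙ}[f] → E_{μ*}[f] for every continuous real-valued f on X. -/

import Mathlib

open MeasureTheory Filter Topology

/-- The adversarial divergence over `X` determined by a family `F` of bounded continuous
functions on `X × X`: `τ(μ‖ν) = sup_{f ∈ F} E_{μ⊗ν}[f]`, with values in `ℝ ∪ {±∞}`. -/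
noncomputable def advDiv {X : Type*} [TopologicalSpace X] [MeasurableSpace X]
    (F : Set (BoundedContinuousFunction (X × X) ℝ))
    (μ ν : ProbabilityMeasure X) : EReal :=
  ⨆ f ∈ F, (((∫ p, f p ∂((μ : Measure X).prod (ν : Measure X))) : ℝ) : EReal)

theorem continuous_integral_prod_right {X : Type*} [MetricSpace X] [CompactSpace X]
    [MeasurableSpace X] [BorelSpace X] (f : BoundedContinuousFunction (X × X) ℝ)
    (μ : ProbabilityMeasure X) :
    Continuous fun ν : ProbabilityMeasure X =>
      ∫ p, f p ∂((μ : Measure X).prod (ν : Measure X)) := by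
  have hprod : Continuous fun ν : ProbabilityMeasure X => μ.prod ν :=
    ProbabilityMeasure.continuous_prod.comp (Continuous.prodMk_right μ)
  exact (ProbabilityMeasure.continuous_integral_boundedContinuousFunction f).comp hprod

theorem lowerSemicontinuous_advDiv {X : Type*} [MetricSpace X] [CompactSpace X]
    [MeasurableSpace X] [BorelSpace X] (F : Set (BoundedContinuousFunction (X × X) ℝ))
    (μ : ProbabilityMeasure X) : LowerSemicontinuous (advDiv F μ) :=
  lowerSemicontinuous_biSup fun f _ =>
    (continuous_coe_real_ereal.comp (continuous_integral_prod_right f μ)).lowerSemicontinuous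

/-- A cluster point of a minimizing family for a lower semicontinuous function is a minimizer. -/
theorem LowerSemicontinuous.eq_iInf_of_mapClusterPt {ι Y β : Type*} [TopologicalSpace Y]
    [CompleteLinearOrder β] [TopologicalSpace β] [OrderTopology β] [DenselyOrdered β]
    {l : Filter ι} {g : Y → β} (hg : LowerSemicontinuous g) {u : ι → Y} {y : Y}
    (hu : Tendsto (fun i => g (u i)) l (𝓝 (⨅ z, g z))) (hy : MapClusterPt y l u) :
    g y = ⨅ z, g z := by
  refine le_antisymm (le_of_not_gt fun hlt => ?_) (iInf_le g y)
  obtain ⟨c, hc, hcy⟩ := exists_between hlt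
  obtain ⟨i, hi, hi'⟩ :=
    ((hy.frequently (hg y c hcy)).and_eventually (hu.eventually_lt_const hc)).exists
  exact lt_asymm hi hi'

/-- On a compact metric space, if `τ` is a strict adversarial divergence
(`OPT_{τ,μ*} = {μ*}` for every `μ*`), then convergence of `τ(μ*‖μₙ)` to the global infimum
of `τ(μ*‖·)` implies weak convergence of `μₙ` to `μ*`: `E_{μₙ}[f] → E_{μ*}[f]` for every
continuous real-valued `f` on `X`. -/
theorem stmt7 {X : Type*} [MetricSpace X] [CompactSpace X]
    [MeasurableSpace X] [BorelSpace X]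
    (F : Set (BoundedContinuousFunction (X × X) ℝ)) (hF : F.Nonempty)
    (hstrict : ∀ μstar : ProbabilityMeasure X,
      {μ : ProbabilityMeasure X |
        advDiv F μstar μ = ⨅ μ' : ProbabilityMeasure X, advDiv F μstar μ'} = {μstar}) :
    ∀ (μstar : ProbabilityMeasure X) (μs : ℕ → ProbabilityMeasure X),
      Tendsto (fun k => advDiv F μstar (μs k)) atTop
        (𝓝 (⨅ μ' : ProbabilityMeasure X, advDiv F μstar μ')) →
      ∀ f : C(X, ℝ),
        Tendsto (fun k => ∫ x, f x ∂(μs k : Measure X)) atTop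
          (𝓝 (∫ x, f x ∂(μstar : Measure X))) := by
  intro μstar μs hμs f
  have hlim : Tendsto μs atTop (𝓝 μstar) := by
    refine isCompact_univ.tendsto_nhds_of_unique_mapClusterPt (by simp) fun μ _ hμ => ?_
    have hopt := (lowerSemicontinuous_advDiv F μstar).eq_iInf_of_mapClusterPt hμs hμ
    exact (hstrict μstar).subset hopt
  exact ((ProbabilityMeasure.continuous_integral_continuousMap f).tendsto μstar).comp hlim
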